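/- Let $\Delta \in (0,1]$, $\rho \in (-1,1)$, and define $u_k = \sum_{k'=1}^k \varrho^{\circ(k'-1)}(\rho) \prod_{k''=k'}^{k-1} \varrho'(\varrho^{\circ(k''-1)}(\rho))$, where $\varrho(\rho) = \rho + \Delta\frac{2}{\pi}(\sqrt{1-\rho^2}-\rho\arccos\rho)$ and $\varrho'(\rho) = 1 - \Delta\frac{2}{\pi}\arccos\rho$. Then for all $k \geq 1$: $u_k \leq \Delta^{-1}\frac{3\pi}{16}\,\omega^{\circ(k-1)}\big((\frac{1-\rho}{2})^{-1/2}\big) - \frac{1}{8}$, where $\omega$ is the inverse cosine distance map. -/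

import Mathlib

open Real

/-- The cosine map `ϱ`. -/
noncomputable def varrho (Δ ρ : ℝ) : ℝ :=
  ρ + Δ * (2 / π) * (Real.sqrt (1 - ρ ^ 2) - ρ * Real.arccos ρ)

/-- The derivative `ϱ'` of the cosine map. -/
noncomputable def varrho' (Δ ρ : ℝ) : ℝ := 1 - Δ * (2 / π) * Real.arccos ρ

/-- The squared cosine distance map. -/
noncomputable def zeta (Δ z : ℝ) : ℝ :=
  z - Δ * (1 / π) *
    (Real.sqrt (1 - (1 - 2 * z) ^ 2) - (1 - 2 * z) * Real.arccos (1 - 2 * z))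

/-- The inverse cosine distance map `ω(w) = ζ(w⁻²)^{-1/2}`. -/
noncomputable def omegaMap (Δ w : ℝ) : ℝ := (Real.sqrt (zeta Δ ((w ^ 2)⁻¹)))⁻¹


namespace UK

/-- The quantity `g = sin θ - θ cos θ` at `θ = 2t`. -/
noncomputable def gg (t : ℝ) : ℝ := Real.sin (2 * t) - 2 * t * Real.cos (2 * t)

noncomputable def WW (x : ℝ) : ℝ := (Real.sqrt ((1 - x) / 2))⁻¹

lemma gg_lower {t : ℝ} (h0 : 0 ≤ t) (h1 : t ≤ π / 2) : 8 / 3 * Real.sin t ^ 3 ≤ gg t := by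
  have hmono : MonotoneOn (fun t : ℝ => gg t - 8 / 3 * Real.sin t ^ 3) (Set.Icc 0 (π / 2)) := by
    have hd : ∀ x : ℝ, HasDerivAt (fun t : ℝ => gg t - 8 / 3 * Real.sin t ^ 3)
        (8 * Real.sin x * Real.cos x * (x - Real.sin x)) x := by
      intro x
      have e1 : HasDerivAt (fun t : ℝ => 2 * t) 2 x := by
        simpa using (hasDerivAt_id x).const_mul (2 : ℝ)
      have h := ((e1.sin).sub (e1.mul e1.cos)).sub
        (((Real.hasDerivAt_sin x).pow 3).const_mul (8 / 3))
      have h' := h.congr_deriv (g' := 8 * Real.sin x * Real.cos x * (x - Real.sin x)) (by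
        rw [Real.sin_two_mul]; push_cast; ring)
      exact h'
    apply monotoneOn_of_deriv_nonneg (convex_Icc _ _)
    · exact fun x _ => (hd x).continuousAt.continuousWithinAt
    · exact fun x _ => (hd x).differentiableAt.differentiableWithinAt
    · intro x hx
      rw [interior_Icc] at hx
      rw [(hd x).deriv]
      have := Real.sin_nonneg_of_nonneg_of_le_pi hx.1.le (by linarith [hx.2, hx.1])
      have := Real.cos_nonneg_of_neg_pi_div_two_le_of_le (by linarith [hx.1, Real.pi_pos]) hx.2.le
      have := Real.sin_le hx.1.le
      have : 0 ≤ x - Real.sin x := by linarith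
      positivity
  have := hmono (Set.mem_Icc.2 ⟨le_refl _, by positivity⟩) (Set.mem_Icc.2 ⟨h0, h1⟩) h0
  simp [gg] at this
  simp only [gg]
  linarith

lemma gg_upper {t : ℝ} (h0 : 0 < t) (h1 : t < π / 2) : gg t < π * Real.sin t ^ 2 := by
  have hs : Real.sin t ^ 2 = (1 - Real.cos (2 * t)) / 2 := by
    rw [Real.cos_two_mul, Real.sin_sq]; ring
  rw [hs, gg]
  rcases le_total (2 * t) (π / 2) with h | h
  · have := Real.sin_lt (x := 2 * t) (by linarith)
    nlinarith [Real.cos_le_one (2 * t)]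
  · have := Real.sin_lt (x := π - 2 * t) (by linarith)
    rw [Real.sin_pi_sub] at this
    nlinarith [Real.neg_one_le_cos (2 * t)]

lemma inv_sqrt_lower {x : ℝ} (h0 : 0 ≤ x) (h1 : x < 1) :
    1 + x / 2 + 3 / 8 * x ^ 2 ≤ (Real.sqrt (1 - x))⁻¹ := by
  have hpos : 0 < Real.sqrt (1 - x) := Real.sqrt_pos.2 (by linarith)
  rw [le_inv_comm₀ (by positivity) hpos, Real.sqrt_le_iff]
  refine ⟨by positivity, ?_⟩
  rw [inv_pow, ← one_div, le_div_iff₀ (by positivity)]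
  have h3 : 0 ≤ x ^ 3 := by positivity
  have h4 : 0 ≤ x ^ 4 := by positivity
  have h5 : 0 ≤ x ^ 5 := by positivity
  nlinarith

lemma core {a s t g : ℝ} (ha : 0 < a) (ha1 : a ≤ 1) (hs : 0 < s) (hs1 : s ≤ 1) (hts : s ≤ t)
    (hg : 8 / 3 * s ^ 3 ≤ g) (hg2 : g < π * s ^ 2) :
    1 - 2 * s ^ 2 + 2 * (a / π) * g + (1 - 4 * (a / π) * t) * (a⁻¹ * (3 * π / 16) * s⁻¹ - 1 / 8) ≤
      a⁻¹ * (3 * π / 16) * (Real.sqrt (s ^ 2 - a / π * g))⁻¹ - 1 / 8 := by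
  have hpi := Real.pi_pos
  have hpi3 := Real.pi_gt_three
  obtain ⟨G, rfl⟩ : ∃ G, g = G * s ^ 3 := ⟨g / s ^ 3, by field_simp⟩
  have hG : 8 / 3 ≤ G := le_of_mul_le_mul_right hg (by positivity)
  obtain ⟨b, hb⟩ : ∃ b, b = a / π := ⟨_, rfl⟩
  have hC : a⁻¹ * (3 * π / 16) = 3 / 16 / b := by rw [hb]; field_simp
  have hbpos : 0 < b := by rw [hb]; positivity
  have hbpi : b * π ≤ 1 := by rw [hb, div_mul_cancel₀ _ hpi.ne']; exact ha1
  rw [hC, ← hb]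
  have hGpos : 0 < G := by linarith
  have hGs : G * s < π := by
    have : (G * s) * s ^ 2 < π * s ^ 2 := by linarith
    exact lt_of_mul_lt_mul_right this (by positivity)
  have hx1 : b * G * s < 1 := by nlinarith
  have hx0 : 0 ≤ b * G * s := by positivity
  have hsq : Real.sqrt (s ^ 2 - b * (G * s ^ 3)) = s * Real.sqrt (1 - b * G * s) := by
    rw [show s ^ 2 - b * (G * s ^ 3) = s ^ 2 * (1 - b * G * s) by ring,
      Real.sqrt_mul (by positivity), Real.sqrt_sq hs.le]
  have hi := inv_sqrt_lower hx0 hx1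
  rw [hsq, mul_inv]
  have hm : 3 / 16 / b * (s⁻¹ * (1 + b * G * s / 2 + 3 / 8 * (b * G * s) ^ 2)) ≤
      3 / 16 / b * (s⁻¹ * (Real.sqrt (1 - b * G * s))⁻¹) := by gcongr
  refine le_trans ?_ (sub_le_sub_right hm _)
  have e1 : 3 / 16 / b * (s⁻¹ * (1 + b * G * s / 2 + 3 / 8 * (b * G * s) ^ 2)) =
      3 / 16 / b * s⁻¹ + 3 * G / 32 + 9 / 128 * b * G ^ 2 * s := by
    field_simp; ring
  have e2 : (1 - 4 * b * t) * (3 / 16 / b * s⁻¹ - 1 / 8) =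
      3 / 16 / b * s⁻¹ - 3 / 4 * (t / s) - 1 / 8 + b * t / 2 := by
    field_simp; ring
  rw [e1, e2]
  have h1 : b * (G * s ^ 3) ≤ s ^ 2 := by
    have : b * G * s * s ^ 2 ≤ 1 * s ^ 2 := by gcongr
    linarith
  have h2 : b * s * (64 / 9) ≤ b * s * G ^ 2 := by
    gcongr
    nlinarith
  have h3 : b * (t - s) / 2 ≤ 3 / 4 * (t / s - 1) := by
    have e : t / s - 1 = (t - s) / s := by field_simp
    have : t - s ≤ (t - s) / s := by
      rw [le_div_iff₀ hs]; nlinarith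
    have hb1 : b ≤ 1 := by nlinarith
    rw [e]; nlinarith
  linarith

lemma varrho_cos {a t : ℝ} (h0 : 0 ≤ t) (h1 : t ≤ π / 2) :
    varrho a (Real.cos (2 * t)) = Real.cos (2 * t) + a * (2 / π) * gg t := by
  have : Real.sqrt (1 - Real.cos (2 * t) ^ 2) = Real.sin (2 * t) := by
    rw [← Real.sin_sq, Real.sqrt_sq]
    exact Real.sin_nonneg_of_nonneg_of_le_pi (by linarith) (by linarith)
  rw [varrho, this, Real.arccos_cos (by linarith) (by linarith), gg]
  ring

lemma exists_t {x : ℝ} (hx : x ∈ Set.Ioo (-1 : ℝ) 1) :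
    ∃ t, 0 < t ∧ t < π / 2 ∧ x = Real.cos (2 * t) ∧ Real.arccos x = 2 * t := by
  refine ⟨Real.arccos x / 2, ?_, ?_, ?_, by ring⟩
  · have := Real.arccos_pos.2 hx.2; linarith
  · have h1 : Real.arccos x ≠ π := by
      intro h
      rw [Real.arccos_eq_pi] at h
      linarith [hx.1]
    have := lt_of_le_of_ne (Real.arccos_le_pi x) h1
    linarith
  · rw [show 2 * (Real.arccos x / 2) = Real.arccos x by ring,
      Real.cos_arccos hx.1.le hx.2.le]

lemma varrho_mem {a x : ℝ} (ha : a ∈ Set.Ioc (0 : ℝ) 1) (hx : x ∈ Set.Ioo (-1 : ℝ) 1) :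
    x ≤ varrho a x ∧ varrho a x ∈ Set.Ioo (-1 : ℝ) 1 := by
  obtain ⟨t, h0, h1, rfl, -⟩ := exists_t hx
  obtain ⟨ha0, ha1⟩ := ha
  have hs : 0 < Real.sin t := Real.sin_pos_of_pos_of_lt_pi h0 (by linarith)
  have hl := gg_lower h0.le h1.le
  have hu := gg_upper h0 h1
  have hgpos : 0 < gg t := lt_of_lt_of_le (by positivity) hl
  have hpi := Real.pi_pos
  rw [varrho_cos h0.le h1.le]
  have hp : 0 < a * (2 / π) * gg t := by positivity
  have hq : a * (2 / π) * gg t < 2 * Real.sin t ^ 2 := by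
    have : a * (2 / π) * gg t ≤ 1 * (2 / π) * gg t := by gcongr
    have h2 : 1 * (2 / π) * gg t < 1 * (2 / π) * (π * Real.sin t ^ 2) := by gcongr
    have h3 : 1 * (2 / π) * (π * Real.sin t ^ 2) = 2 * Real.sin t ^ 2 := by field_simp
    linarith
  have hc : Real.cos (2 * t) = 1 - 2 * Real.sin t ^ 2 := by
    rw [Real.cos_two_mul, Real.sin_sq]; ring
  exact ⟨by linarith, by linarith [hx.1], by linarith⟩

lemma step {a x : ℝ} (ha : a ∈ Set.Ioc (0 : ℝ) 1) (hx : x ∈ Set.Ioo (-1 : ℝ) 1) :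
    varrho a x + varrho' a x * (a⁻¹ * (3 * π / 16) * WW x - 1 / 8) ≤
      a⁻¹ * (3 * π / 16) * WW (varrho a x) - 1 / 8 := by
  obtain ⟨t, h0, h1, rfl, h2⟩ := exists_t hx
  obtain ⟨ha0, ha1⟩ := ha
  have hs : 0 < Real.sin t := Real.sin_pos_of_pos_of_lt_pi h0 (by linarith)
  have hl := gg_lower h0.le h1.le
  have hu := gg_upper h0 h1
  have hc : Real.cos (2 * t) = 1 - 2 * Real.sin t ^ 2 := by
    rw [Real.cos_two_mul, Real.sin_sq]; ring
  have key := core ha0 ha1 hs (Real.sin_le_one t) (Real.sin_le h0.le) hl hu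
  rw [varrho', h2, varrho_cos h0.le h1.le, WW, WW]
  have e1 : (1 - Real.cos (2 * t)) / 2 = Real.sin t ^ 2 := by rw [hc]; ring
  have e2 : (1 - (Real.cos (2 * t) + a * (2 / π) * gg t)) / 2 =
      Real.sin t ^ 2 - a / π * gg t := by rw [hc]; ring
  rw [e1, e2, Real.sqrt_sq hs.le, hc]
  convert key using 2 <;> ring

lemma base {a x : ℝ} (ha : a ∈ Set.Ioc (0 : ℝ) 1) (hx : x ∈ Set.Ioo (-1 : ℝ) 1) :
    x ≤ a⁻¹ * (3 * π / 16) * WW x - 1 / 8 := by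
  have hpi3 := Real.pi_gt_three
  set y := Real.sqrt ((1 - x) / 2) with hy
  have hy0 : 0 < y := Real.sqrt_pos.2 (by linarith [hx.2])
  have hy2 : y ^ 2 = (1 - x) / 2 := Real.sq_sqrt (by linarith [hx.2])
  have h1 : 1 ≤ a⁻¹ := (one_le_inv₀ ha.1).2 ha.2
  have h2 : (9 / 16 : ℝ) ≤ a⁻¹ * (3 * π / 16) := by nlinarith
  have h3 : 9 / 16 * y⁻¹ ≤ a⁻¹ * (3 * π / 16) * y⁻¹ := by gcongr
  rw [WW, ← hy]
  have h4 : 9 / 8 - 2 * y ^ 2 ≤ 9 / 16 * y⁻¹ := by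
    rw [← div_eq_mul_inv, le_div_iff₀ hy0]
    nlinarith [mul_nonneg hy0.le (sq_nonneg (y - 7 / 16)), sq_nonneg (y - 7 / 16)]
  linarith

lemma cos_sin_bound {φ : ℝ} (h0 : 0 ≤ φ) (h1 : φ ≤ π / 2) :
    1 ≤ φ * Real.sin φ + Real.cos φ := by
  have hc := Real.one_sub_sq_div_two_le_cos (x := φ)
  have hpi : π < 3.15 := Real.pi_lt_d2
  have hs : 2 / π * φ ≤ Real.sin φ := Real.mul_le_sin h0 h1
  have h2 : (1 / 2 : ℝ) ≤ 2 / π := by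
    rw [le_div_iff₀ Real.pi_pos]; linarith
  nlinarith

lemma final_bound {φ b r : ℝ} (h0 : 0 ≤ φ) (h1 : φ ≤ π / 2) (hs0 : 0 ≤ Real.sin φ)
    (hc0 : 0 ≤ Real.cos φ) (hb : 0.623 ≤ b)
    (hr : b * (φ * Real.sin φ + Real.cos φ) - 0.02 ≤ r) :
    0.4847 ≤ 0.683 * r + b * Real.cos φ := by
  rcases le_total 0.2 (Real.cos φ) with hc | hc
  · have hX : (0.623 : ℝ) * 1 ≤ b * (φ * Real.sin φ + Real.cos φ) :=
      mul_le_mul hb (cos_sin_bound h0 h1) (by norm_num) (by linarith)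
    have hY : (0.623 : ℝ) * 0.2 ≤ b * Real.cos φ :=
      mul_le_mul hb hc (by norm_num) (by linarith)
    linarith
  · have hcc := Real.one_sub_sq_div_two_le_cos (x := φ)
    have hφ2 : 1.26 ≤ φ := by
      by_contra hlt
      push Not at hlt
      nlinarith
    have hs2 : 0.97 ≤ Real.sin φ := by
      have := Real.sin_sq_add_cos_sq φ
      have hc2 : Real.cos φ ^ 2 ≤ 0.2 ^ 2 := pow_le_pow_left₀ hc0 hc 2
      by_contra hlt
      push Not at hlt
      nlinarith
    have h3 : (1.26 : ℝ) * 0.97 ≤ φ * Real.sin φ :=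
      mul_le_mul hφ2 hs2 (by norm_num) (by linarith)
    have hX : (0.623 : ℝ) * 1.22 ≤ b * (φ * Real.sin φ + Real.cos φ) :=
      mul_le_mul hb (by linarith) (by norm_num) (by linarith)
    have hY : 0 ≤ b * Real.cos φ := mul_nonneg (by linarith) hc0
    linarith

/-- the exceptional first step, where the derivative is negative -/
lemma exceptional {a x : ℝ} (ha : a ∈ Set.Ioc (0 : ℝ) 1) (hx : x ∈ Set.Ioo (-1 : ℝ) 1)
    (hneg : varrho' a x < 0) :
    0 ≤ varrho a x ∧
    varrho a x + varrho' a x * x ≤ a⁻¹ * (3 * π / 16) * WW (varrho a x) - 1 / 8 := by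
  obtain ⟨-, hr⟩ := varrho_mem ha hx
  obtain ⟨ha0, ha1⟩ := ha
  have hpi := Real.pi_pos
  have hpl : 3.1415 < π := Real.pi_gt_d4
  have hpu : π < 3.1416 := Real.pi_lt_d4
  set b := a * (2 / π) with hb
  have hbpos : 0 < b := by positivity
  have hbpi : b * π = 2 * a := by rw [hb]; field_simp
  obtain ⟨φ, hφ⟩ : ∃ φ, φ = Real.arccos x - π / 2 := ⟨_, rfl⟩
  have hth : Real.arccos x = φ + π / 2 := by linarith
  have hp : varrho' a x = 1 - a - b * φ := by
    rw [varrho', ← hb, hth]; linarith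
  have hφ0 : 0 < φ := by
    rw [hp] at hneg
    by_contra h
    nlinarith
  have hφ1 : φ ≤ π / 2 := by linarith [Real.arccos_le_pi x]
  have hxs : x = -Real.sin φ := by
    rw [← Real.cos_add_pi_div_two, ← hth, Real.cos_arccos hx.1.le hx.2.le]
  have hsin : Real.sqrt (1 - x ^ 2) = Real.cos φ := by
    rw [← Real.sin_arccos, hth, Real.sin_add_pi_div_two]
  have hv : varrho a x = varrho' a x * x + b * Real.cos φ := by
    rw [varrho, varrho', hsin]; ring
  have hs0 : 0 ≤ Real.sin φ := Real.sin_nonneg_of_nonneg_of_le_pi hφ0.le (by linarith)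
  have hc0 : 0 ≤ Real.cos φ :=
    Real.cos_nonneg_of_neg_pi_div_two_le_of_le (by linarith) hφ1
  have hq : 0 ≤ varrho' a x * x := by
    exact mul_nonneg_of_nonpos_of_nonpos hneg.le (by rw [hxs]; linarith)
  have hbc : 0 ≤ b * Real.cos φ := by positivity
  refine ⟨by linarith, ?_⟩
  set r := varrho a x with hrdef
  have hu : varrho' a x * x = r - b * Real.cos φ := by linarith
  rw [hu, WW]
  set y := Real.sqrt ((1 - r) / 2) with hy
  have hy0 : 0 < y := Real.sqrt_pos.2 (by linarith [hr.2])
  have hy2 : y ^ 2 = (1 - r) / 2 := Real.sq_sqrt (by linarith [hr.2])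
  rcases le_total a 0.98 with h | h
  · have h1 : (0.98 : ℝ)⁻¹ ≤ a⁻¹ := inv_anti₀ ha0 h
    have h2 : (0.6 : ℝ) ≤ a⁻¹ * (3 * π / 16) := by
      have : (0.98 : ℝ)⁻¹ * (3 * π / 16) ≤ a⁻¹ * (3 * π / 16) := by gcongr
      refine le_trans ?_ this
      norm_num
      linarith
    have h3 : 0.6 * y⁻¹ ≤ a⁻¹ * (3 * π / 16) * y⁻¹ := by gcongr
    have h4 : 17 / 8 - 4 * y ^ 2 ≤ 0.6 * y⁻¹ := by
      rw [← div_eq_mul_inv, le_div_iff₀ hy0]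
      nlinarith [mul_nonneg hy0.le (sq_nonneg (y - 0.421)), sq_nonneg (y - 0.421)]
    linarith
  · have h1 : 1 ≤ a⁻¹ := (one_le_inv₀ ha0).2 ha1
    have h2 : (0.589 : ℝ) ≤ a⁻¹ * (3 * π / 16) := by nlinarith
    have h3 : 0.589 * y⁻¹ ≤ a⁻¹ * (3 * π / 16) * y⁻¹ := by gcongr
    have h4 : 3.947 - 9.113 * y ^ 2 ≤ y⁻¹ := by
      rw [← one_div, le_div_iff₀ hy0]
      nlinarith [mul_nonneg hy0.le (sq_nonneg (y - 0.38)), sq_nonneg (y - 0.38)]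
    have hb2 : 0.623 ≤ b := by nlinarith
    have hrr : r = b * (φ * Real.sin φ + Real.cos φ) - (1 - a) * Real.sin φ := by
      rw [hv, hp, hxs]; ring
    have hs1 := Real.sin_le_one φ
    have hr2 : b * (φ * Real.sin φ + Real.cos φ) - 0.02 ≤ r := by
      have : (1 - a) * Real.sin φ ≤ 0.02 * 1 :=
        mul_le_mul (by linarith) hs1 hs0 (by norm_num)
      linarith
    have fin := final_bound hφ0.le hφ1 hs0 hc0 hb2 hr2
    linarith

lemma deriv_next {a x : ℝ} (ha : a ∈ Set.Ioc (0 : ℝ) 1) (hx : x ∈ Set.Ioo (-1 : ℝ) 1) :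
    0 ≤ varrho' a (varrho a x) := by
  have hpi := Real.pi_pos
  obtain ⟨hle, hr⟩ := varrho_mem ha hx
  have hb : 0 < a * (2 / π) := by have := ha.1; positivity
  rcases lt_or_ge (varrho' a x) 0 with h | h
  · have h0 := (exceptional ha hx h).1
    have : Real.arccos (varrho a x) ≤ π / 2 := Real.arccos_le_pi_div_two.2 h0
    have h2 : a * (2 / π) * Real.arccos (varrho a x) ≤ a * (2 / π) * (π / 2) := by gcongr
    have h3 : a * (2 / π) * (π / 2) = a := by field_simp
    rw [varrho']; linarith [ha.2]
  · have : Real.arccos (varrho a x) ≤ Real.arccos x := Real.arccos_le_arccos hle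
    have h2 : a * (2 / π) * Real.arccos (varrho a x) ≤ a * (2 / π) * Real.arccos x := by gcongr
    rw [varrho'] at h ⊢; linarith

lemma omega_WW {a x : ℝ} (hx : x < 1) : omegaMap a (WW x) = WW (varrho a x) := by
  have e : ((WW x) ^ 2)⁻¹ = (1 - x) / 2 := by
    rw [WW, inv_pow, inv_inv, Real.sq_sqrt (by linarith)]
  rw [omegaMap, e, WW, zeta, varrho, show 1 - 2 * ((1 - x) / 2) = x by ring]
  congr 2
  ring

lemma iter_mem {a x : ℝ} (ha : a ∈ Set.Ioc (0 : ℝ) 1) (hx : x ∈ Set.Ioo (-1 : ℝ) 1) (n : ℕ) :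
    (varrho a)^[n] x ∈ Set.Ioo (-1 : ℝ) 1 := by
  induction n with
  | zero => simpa using hx
  | succ n ih => rw [Function.iterate_succ_apply']; exact (varrho_mem ha ih).2

lemma iter_omega {a x : ℝ} (ha : a ∈ Set.Ioc (0 : ℝ) 1) (hx : x ∈ Set.Ioo (-1 : ℝ) 1) (n : ℕ) :
    (omegaMap a)^[n] (WW x) = WW ((varrho a)^[n] x) := by
  induction n with
  | zero => rfl
  | succ n ih =>
    rw [Function.iterate_succ_apply', ih, Function.iterate_succ_apply',
      omega_WW (iter_mem ha hx n).2]

/-- `uu a x n` is `u_{n+1}`. -/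
noncomputable def uu (a x : ℝ) (n : ℕ) : ℝ :=
  ∑ i ∈ Finset.range (n + 1),
    (varrho a)^[i] x * ∏ j ∈ Finset.Ico i n, varrho' a ((varrho a)^[j] x)

lemma uu_succ (a x : ℝ) (n : ℕ) :
    uu a x (n + 1) = (varrho a)^[n + 1] x + varrho' a ((varrho a)^[n] x) * uu a x n := by
  rw [uu, Finset.sum_range_succ, uu, Finset.mul_sum, add_comm]
  congr 1
  · simp
  · refine Finset.sum_congr rfl fun i hi => ?_
    rw [Finset.prod_Ico_succ_top (by simpa [Nat.lt_succ_iff] using hi)]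
    ring

lemma main {a x : ℝ} (ha : a ∈ Set.Ioc (0 : ℝ) 1) (hx : x ∈ Set.Ioo (-1 : ℝ) 1) (n : ℕ) :
    uu a x n ≤ a⁻¹ * (3 * π / 16) * WW ((varrho a)^[n] x) - 1 / 8 := by
  induction n with
  | zero => simpa [uu] using base ha hx
  | succ n ih =>
    have hm := iter_mem ha hx n
    have hst := step ha hm
    rw [uu_succ, Function.iterate_succ_apply']
    rcases lt_or_ge (varrho' a ((varrho a)^[n] x)) 0 with h | h
    · cases n with
      | zero => simpa [uu] using (exceptional ha hx h).2
      | succ m =>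
        rw [Function.iterate_succ_apply'] at h
        exact absurd (deriv_next ha (iter_mem ha hx m)) (not_le.2 h)
    · have := mul_le_mul_of_nonneg_left ih h
      linarith

end UK

/-- Upper bound for `u_k = ∑_{k'=1}^k ϱ^{∘(k'-1)}(ρ) ∏_{k''=k'}^{k-1} ϱ'(ϱ^{∘(k''-1)}(ρ))`:
`u_k ≤ Δ⁻¹ (3π/16) ω^{∘(k-1)}(((1-ρ)/2)^{-1/2}) - 1/8`. -/
theorem u_k_upper_bound (Δ : ℝ) (hΔ : Δ ∈ Set.Ioc (0 : ℝ) 1)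
    (ρ : ℝ) (hρ : ρ ∈ Set.Ioo (-1 : ℝ) 1) (k : ℕ) (hk : 1 ≤ k) :
    (∑ i ∈ Finset.range k,
        (varrho Δ)^[i] ρ * ∏ j ∈ Finset.Ico i (k - 1), varrho' Δ ((varrho Δ)^[j] ρ)) ≤
      Δ⁻¹ * (3 * π / 16) * (omegaMap Δ)^[k - 1] ((Real.sqrt ((1 - ρ) / 2))⁻¹) - 1 / 8 := by
  obtain ⟨n, rfl⟩ : ∃ n, k = n + 1 := ⟨k - 1, by omega⟩
  have h := UK.main hΔ hρ n
  rw [← UK.iter_omega hΔ hρ n] at h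
  exact h
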